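/- arXiv:1910.08540 — 3 statements merged into one kernel-verified Lean document; each statement's English description precedes it below -/
import Mathlib

section
/- Let μ be a σ-finite measure on a measurable space X and let f, g : X → [0, ∞) be measurable with f(x) + g(x) > 0 for μ-a.e. x. Then for every measurable function D : X → (0, 1), the (possibly −∞-valued) integral ∫ (f·log D + g·log(1 − D)) dμ is at most ∫ (f·log(f/(f+g)) + g·log(g/(f+g))) dμ; i.e., the discriminator D*(x) = f(x)/(f(x) + g(x)) maximizes the objective ∫ (f·log D + g·log(1 − D)) dμ over all measurable D : X → (0,1). -/
open MeasureTheory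

lemma gibbs_aux (a s d : ℝ) (ha : 0 ≤ a) (hs : 0 < s) (hd : 0 < d) :
    a * Real.log d - a * Real.log (a / s) ≤ s * d - a := by
  rcases ha.eq_or_lt with h | h
  · subst h
    simp only [zero_mul, sub_zero]
    positivity
  · have h1 : Real.log (d / (a / s)) ≤ d / (a / s) - 1 :=
      Real.log_le_sub_one_of_pos (by positivity)
    rw [Real.log_div hd.ne' (by positivity)] at h1
    have h2 := mul_le_mul_of_nonneg_left h1 ha
    have h3 : a * (d / (a / s) - 1) = s * d - a := by
      field_simp
    linarith

/-- Lemma 3.1 (optimal discriminator): for measurable densities `f, g : X → [0, ∞)`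
with `f + g > 0` a.e., and any measurable `D : X → (0, 1)`, the (possibly `-∞`-valued)
objective `∫ (f·log D + g·log (1 - D)) dμ` is at most
`∫ (f·log (f/(f+g)) + g·log (g/(f+g))) dμ`.  Both integrands are nonpositive, so the
inequality is expressed via the `ℝ≥0∞`-valued integrals of their negations
(the inequality of the negations is reversed). -/
theorem optimal_discriminator_integral {X : Type*} [MeasurableSpace X]
    (μ : Measure X) [SigmaFinite μ]
    (f g : X → ℝ) (hf : Measurable f) (hg : Measurable g)
    (hf0 : ∀ x, 0 ≤ f x) (hg0 : ∀ x, 0 ≤ g x)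
    (hpos : ∀ᵐ x ∂μ, 0 < f x + g x)
    (D : X → ℝ) (hD : Measurable D) (hD01 : ∀ x, D x ∈ Set.Ioo (0 : ℝ) 1) :
    ∫⁻ x, ENNReal.ofReal
        (-(f x * Real.log (f x / (f x + g x)) + g x * Real.log (g x / (f x + g x)))) ∂μ
      ≤ ∫⁻ x, ENNReal.ofReal
        (-(f x * Real.log (D x) + g x * Real.log (1 - D x))) ∂μ := by
  apply lintegral_mono_ae
  filter_upwards [hpos] with x hx
  apply ENNReal.ofReal_le_ofReal
  obtain ⟨h0, h1⟩ := hD01 x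
  have e1 := gibbs_aux (f x) (f x + g x) (D x) (hf0 x) hx h0
  have e2 := gibbs_aux (g x) (f x + g x) (1 - D x) (hg0 x) hx (by linarith)
  linarith
end

section
/- Let p and q be probability measures on a measurable space X. Then the supremum over all measurable functions D : X → (0, 1) of E_{x∼p}[log D(x)] + E_{x∼q}[log(1 − D(x))] equals −log 4 + 2·JSD(p, q). -/
open MeasureTheory Classical
open scoped ENNReal

/-- The Kullback–Leibler divergence `KL(μ ‖ ν)`, valued in `[0, ∞]`.
If `μ ≪ ν` it is the integral of the nonnegative function
`klFun (dμ/dν) = (dμ/dν) log (dμ/dν) - dμ/dν + 1` against `ν` (for probability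
measures this coincides with `∫ log (dμ/dν) dμ`, infinite when that integrand
is not integrable); if `μ` is not absolutely continuous w.r.t. `ν` it is `∞`. -/
noncomputable def klDiv {X : Type*} [MeasurableSpace X] (μ ν : Measure X) : ℝ≥0∞ :=
  if μ ≪ ν then
    ∫⁻ x, ENNReal.ofReal
      ((μ.rnDeriv ν x).toReal * Real.log (μ.rnDeriv ν x).toReal
        - (μ.rnDeriv ν x).toReal + 1) ∂ν
  else ∞

/-- The Jensen–Shannon divergence
`JSD(p, q) = ½ KL(p ‖ m) + ½ KL(q ‖ m)` with `m = ½ (p + q)`. -/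
noncomputable def jsDiv {X : Type*} [MeasurableSpace X] (p q : Measure X) : ℝ≥0∞ :=
  (1 / 2) * klDiv p ((1 / 2 : ℝ≥0∞) • (p + q))
    + (1 / 2) * klDiv q ((1 / 2 : ℝ≥0∞) • (p + q))

lemma aux_one {f D : ℝ} (hf : 0 ≤ f) (hD : 0 < D) :
    f - 2 * D ≤ f * Real.log f + f * (-Real.log D) - f * Real.log 2 := by
  rcases hf.eq_or_lt with rfl | hf
  · simp; exact hD.le
  · have h := Real.log_le_sub_one_of_pos (x := 2 * D / f) (by positivity)
    rw [Real.log_div (by positivity) hf.ne', Real.log_mul (by norm_num) hD.ne'] at h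
    have h2 := mul_le_mul_of_nonneg_left h hf.le
    have h3 : f * (2 * D / f - 1) = 2 * D - f := by field_simp
    rw [h3] at h2
    linarith

lemma log_four : Real.log 4 = 2 * Real.log 2 := by
  rw [show (4:ℝ) = 2 ^ 2 by norm_num, Real.log_pow]; norm_num

lemma aux_lower {f g D : ℝ} (hf : 0 ≤ f) (hg : 0 ≤ g) (h : f + g = 2)
    (hD : D ∈ Set.Ioo (0 : ℝ) 1) :
    Real.log 4 ≤ f * (-Real.log D) + g * (-Real.log (1 - D))
      + (f * Real.log f + g * Real.log g) := by
  have h1 := aux_one hf hD.1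
  have h2 := aux_one (D := 1 - D) hg (by linarith [hD.2])
  have : f * Real.log 2 + g * Real.log 2 = 2 * Real.log 2 := by rw [← add_mul, h]
  rw [log_four]; linarith

lemma aux_two {f D a : ℝ} (hf : 0 ≤ f) (ha : 0 < a) (hD : a * (f / 2) ≤ D) :
    f * Real.log f + f * (-Real.log D) ≤ f * (Real.log 2 - Real.log a) := by
  rcases hf.eq_or_lt with rfl | hf
  · simp
  · have h := Real.log_le_log (by positivity) hD
    rw [Real.log_mul ha.ne' (by positivity), Real.log_div hf.ne' (by norm_num)] at h
    rw [← mul_add]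
    exact mul_le_mul_of_nonneg_left (by linarith) hf.le

lemma kl_nonneg {f : ℝ} (hf : 0 ≤ f) : 0 ≤ f * Real.log f - f + 1 := by
  have := InformationTheory.klFun_nonneg hf
  rw [InformationTheory.klFun] at this; linarith

lemma key {X : Type*} [MeasurableSpace X]
    (p q ν : Measure X) [IsProbabilityMeasure p] [IsProbabilityMeasure q]
    [IsProbabilityMeasure ν] (hp : p ≪ ν) (hq : q ≪ ν)
    (hfg : ∀ᵐ x ∂ν, (p.rnDeriv ν x).toReal + (q.rnDeriv ν x).toReal = 2)
    (D : X → ℝ) (hDm : Measurable D) (hD : ∀ x, D x ∈ Set.Ioo (0 : ℝ) 1) :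
    (∫⁻ x, ENNReal.ofReal (-Real.log (D x)) ∂p
          + ∫⁻ x, ENNReal.ofReal (-Real.log (1 - D x)) ∂q) + (klDiv p ν + klDiv q ν)
    = ∫⁻ x, ENNReal.ofReal ((p.rnDeriv ν x).toReal * (-Real.log (D x))
        + (q.rnDeriv ν x).toReal * (-Real.log (1 - D x))
        + ((p.rnDeriv ν x).toReal * Real.log (p.rnDeriv ν x).toReal
        + (q.rnDeriv ν x).toReal * Real.log (q.rnDeriv ν x).toReal)) ∂ν := by
  have mp := Measure.measurable_rnDeriv p ν
  have mq := Measure.measurable_rnDeriv q ν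
  rw [klDiv, klDiv, if_pos hp, if_pos hq]
  rw [← lintegral_rnDeriv_mul hp (by fun_prop), ← lintegral_rnDeriv_mul hq (by fun_prop)]
  rw [← lintegral_add_left (by fun_prop), ← lintegral_add_left (by fun_prop),
    ← lintegral_add_left (by fun_prop)]
  refine lintegral_congr_ae ?_
  filter_upwards [hfg, p.rnDeriv_lt_top ν, q.rnDeriv_lt_top ν] with x hx hpx hqx
  have e1 := ENNReal.ofReal_toReal hpx.ne
  have e2 := ENNReal.ofReal_toReal hqx.ne
  have h1 : 0 ≤ (p.rnDeriv ν x).toReal := ENNReal.toReal_nonneg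
  have h2 : 0 ≤ (q.rnDeriv ν x).toReal := ENNReal.toReal_nonneg
  have l1 : 0 ≤ -Real.log (D x) := by
    have := Real.log_nonpos (hD x).1.le (hD x).2.le
    linarith
  have l2 : 0 ≤ -Real.log (1 - D x) := by
    have := Real.log_nonpos (x := 1 - D x) (by linarith [(hD x).2]) (by linarith [(hD x).1])
    linarith
  have k1 := kl_nonneg h1
  have k2 := kl_nonneg h2
  nth_rw 1 [← e1]
  nth_rw 1 [← e2]
  rw [← ENNReal.ofReal_mul h1, ← ENNReal.ofReal_mul h2,
    ← ENNReal.ofReal_add (by positivity) (by positivity), ← ENNReal.ofReal_add k1 k2,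
    ← ENNReal.ofReal_add (by positivity) (by positivity)]
  congr 1
  linarith

/-- For probability measures `p, q`, the supremum over measurable `D : X → (0, 1)` of
`E_{x∼p}[log D x] + E_{x∼q}[log (1 - D x)]` equals `-log 4 + 2 · JSD(p, q)`.
Since the objective is everywhere nonpositive, it is encoded via the `ℝ≥0∞`-valued
integrals of the negated integrands: the supremum statement is equivalent to
`(⨅ D, ∫⁻ -log D ∂p + ∫⁻ -log (1 - D) ∂q) + 2 · JSD(p, q) = log 4`. -/
theorem iSup_discriminator_objective_eq_jsDiv {X : Type*} [MeasurableSpace X]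
    (p q : Measure X) [IsProbabilityMeasure p] [IsProbabilityMeasure q] :
    (⨅ (D : X → ℝ) (_ : Measurable D) (_ : ∀ x, D x ∈ Set.Ioo (0 : ℝ) 1),
        (∫⁻ x, ENNReal.ofReal (-Real.log (D x)) ∂p
          + ∫⁻ x, ENNReal.ofReal (-Real.log (1 - D x)) ∂q))
      + 2 * jsDiv p q = ENNReal.ofReal (Real.log 4) := by
  set ν : Measure X := (1 / 2 : ℝ≥0∞) • (p + q) with hν
  have h2ν : p + q = (2 : ℝ≥0∞) • ν := by
    rw [hν, smul_smul, one_div, ENNReal.mul_inv_cancel (by norm_num) (by norm_num), one_smul]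
  haveI : IsProbabilityMeasure ν := ⟨by
    simp only [hν, Measure.smul_apply, Measure.add_apply, measure_univ, smul_eq_mul]
    rw [one_add_one_eq_two, one_div, ENNReal.inv_mul_cancel (by norm_num) (by norm_num)]⟩
  have hpq : p + q ≪ ν := by rw [h2ν]; exact Measure.smul_absolutelyContinuous
  have hp : p ≪ ν := (Measure.absolutelyContinuous_of_le (Measure.le_add_right le_rfl)).trans hpq
  have hq : q ≪ ν := (Measure.absolutelyContinuous_of_le (Measure.le_add_left le_rfl)).trans hpq
  have hfg : ∀ᵐ x ∂ν, (p.rnDeriv ν x).toReal + (q.rnDeriv ν x).toReal = 2 := by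
    have h1 := Measure.rnDeriv_add' p q ν
    rw [h2ν] at h1
    have h3 := Measure.rnDeriv_smul_left_of_ne_top' ν ν (r := (2 : ℝ≥0∞)) (by norm_num)
    filter_upwards [h1, h3, ν.rnDeriv_self, p.rnDeriv_lt_top ν, q.rnDeriv_lt_top ν]
      with x a b c d e
    rw [← ENNReal.toReal_add d.ne e.ne]
    rw [b] at a
    simp only [Pi.add_apply, Pi.smul_apply, c, smul_eq_mul, mul_one] at a
    rw [← a]; rfl
  have hjs : 2 * jsDiv p q = klDiv p ν + klDiv q ν := by
    rw [jsDiv, ← hν, ← mul_add, ← mul_assoc, one_div,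
      ENNReal.mul_inv_cancel (by norm_num) (by norm_num), one_mul]
  rw [hjs]
  apply le_antisymm
  · refine ENNReal.le_of_forall_pos_le_add fun δ hδ _ => ?_
    set a : ℝ := Real.exp (-(δ / 2)) with ha
    have hδ' : (0 : ℝ) < δ := hδ
    have ha0 : 0 < a := Real.exp_pos _
    have ha1 : a < 1 := by rw [ha, Real.exp_lt_one_iff]; linarith
    have hla : Real.log a = -(δ / 2) := Real.log_exp _
    have mp := Measure.measurable_rnDeriv p ν
    let D : X → ℝ := fun x => a * (min (p.rnDeriv ν x).toReal 2 / 2) + (1 - a) / 2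
    have hDm : Measurable D := by fun_prop
    have hD : ∀ x, D x ∈ Set.Ioo (0 : ℝ) 1 := fun x => by
      have h1 : 0 ≤ min (p.rnDeriv ν x).toReal 2 := le_min ENNReal.toReal_nonneg (by norm_num)
      have h2 : min (p.rnDeriv ν x).toReal 2 ≤ 2 := min_le_right _ _
      constructor
      · have : 0 ≤ a * (min (p.rnDeriv ν x).toReal 2 / 2) := by positivity
        simp only [D]; linarith
      · have : a * (min (p.rnDeriv ν x).toReal 2 / 2) ≤ a * 1 :=
          mul_le_mul_of_nonneg_left (by linarith) ha0.le
        simp only [D]; linarith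
    refine (add_le_add_left ((iInf_le _ D).trans ((iInf_le _ hDm).trans (iInf_le _ hD))) _).trans ?_
    rw [key p q ν hp hq hfg D hDm hD]
    calc _ ≤ ∫⁻ x, (ENNReal.ofReal (Real.log 4) + δ) ∂ν := ?_
      _ = _ := by simp
    refine lintegral_mono_ae ?_
    filter_upwards [hfg] with x hx
    have h1 : 0 ≤ (p.rnDeriv ν x).toReal := ENNReal.toReal_nonneg
    have h2 : 0 ≤ (q.rnDeriv ν x).toReal := ENNReal.toReal_nonneg
    have hm : min (p.rnDeriv ν x).toReal 2 = (p.rnDeriv ν x).toReal := min_eq_left (by linarith)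
    have t1 := aux_two (D := D x) h1 ha0 (by simp only [D, hm]; linarith)
    have t2 := aux_two (D := 1 - D x) h2 ha0 (by
      simp only [D, hm]
      rw [show (q.rnDeriv ν x).toReal = 2 - (p.rnDeriv ν x).toReal by linarith]
      linarith)
    rw [← ENNReal.ofReal_coe_nnreal, ← ENNReal.ofReal_add (Real.log_nonneg (by norm_num)) hδ'.le]
    apply ENNReal.ofReal_le_ofReal
    have : (p.rnDeriv ν x).toReal * (Real.log 2 - Real.log a)
      + (q.rnDeriv ν x).toReal * (Real.log 2 - Real.log a) = 2 * (Real.log 2 - Real.log a) := by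
      rw [← add_mul, hx]
    rw [hla] at this t1 t2
    rw [log_four]
    linarith
  · simp only [ENNReal.iInf_add]
    refine le_iInf fun D => le_iInf fun hDm => le_iInf fun hD => ?_
    rw [key p q ν hp hq hfg D hDm hD]
    calc _ = ∫⁻ x, ENNReal.ofReal (Real.log 4) ∂ν := by simp
      _ ≤ _ := ?_
    refine lintegral_mono_ae ?_
    filter_upwards [hfg] with x hx
    exact ENNReal.ofReal_le_ofReal
      (aux_lower ENNReal.toReal_nonneg ENNReal.toReal_nonneg hx (hD x))
end

section
/- Let p, q, r be probability measures on a measurable space X and let β ∈ (0, 1). Then 2·JSD(p, ½(q + r)) + KL(β·p + (1 − β)·q ‖ r) ≥ 0, and this quantity equals 0 if and only if p = q = r. -/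
open MeasureTheory Classical
open scoped ENNReal

theorem klDiv_eq_mathlib {X : Type*} [MeasurableSpace X] (μ ν : Measure X)
    [IsFiniteMeasure μ] [IsFiniteMeasure ν] : klDiv μ ν = InformationTheory.klDiv μ ν := by
  rw [InformationTheory.klDiv_eq_lintegral_klFun, klDiv]
  congr 1
  refine lintegral_congr fun x => ?_
  rw [InformationTheory.klFun]
  congr 1
  ring

theorem klDiv_zero_iff {X : Type*} [MeasurableSpace X] (μ ν : Measure X)
    [IsFiniteMeasure μ] [IsFiniteMeasure ν] : klDiv μ ν = 0 ↔ μ = ν := by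
  rw [klDiv_eq_mathlib, InformationTheory.klDiv_eq_zero_iff]

theorem real_add_fin {X : Type*} [MeasurableSpace X] (μ ν : Measure X)
    [IsFiniteMeasure μ] [IsFiniteMeasure ν] (s : Set X) :
    (μ + ν).real s = μ.real s + ν.real s :=
  measureReal_add_apply

theorem half_smul_add_self {X : Type*} [MeasurableSpace X] (μ : Measure X) :
    (1 / 2 : ℝ≥0∞) • (μ + μ) = μ := by
  rw [smul_add, ← add_smul, ENNReal.add_halves, one_smul]

/-- Theorem 3.2 (measure-theoretic core): for probability measures `p, q, r` and
`β ∈ (0, 1)`, the quantity `2·JSD(p, ½(q + r)) + KL(β·p + (1 - β)·q ‖ r)` is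
nonnegative, and it vanishes if and only if `p = q = r`. -/
theorem jsDiv_add_klDiv_eq_zero_iff {X : Type*} [MeasurableSpace X]
    (p q r : Measure X) [IsProbabilityMeasure p] [IsProbabilityMeasure q]
    [IsProbabilityMeasure r] (β : ℝ) (hβ : β ∈ Set.Ioo (0 : ℝ) 1) :
    0 ≤ 2 * jsDiv p ((1 / 2 : ℝ≥0∞) • (q + r))
        + klDiv (ENNReal.ofReal β • p + ENNReal.ofReal (1 - β) • q) r ∧
      (2 * jsDiv p ((1 / 2 : ℝ≥0∞) • (q + r))
        + klDiv (ENNReal.ofReal β • p + ENNReal.ofReal (1 - β) • q) r = 0 ↔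
          p = q ∧ q = r) := by
  obtain ⟨h0, h1⟩ := hβ
  refine ⟨zero_le, ?_⟩
  have f1 : IsFiniteMeasure ((1 / 2 : ℝ≥0∞) • (q + r)) :=
    Measure.smul_finite _ (by simp)
  have f2 : IsFiniteMeasure ((1 / 2 : ℝ≥0∞) • (p + (1 / 2 : ℝ≥0∞) • (q + r))) :=
    Measure.smul_finite _ (by simp)
  have f3 : IsFiniteMeasure (ENNReal.ofReal β • p) := Measure.smul_finite _ (by simp)
  have f4 : IsFiniteMeasure (ENNReal.ofReal (1 - β) • q) := Measure.smul_finite _ (by simp)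
  constructor
  · intro h
    rw [add_eq_zero, jsDiv] at h
    obtain ⟨ha, hb⟩ := h
    rw [klDiv_zero_iff] at hb
    have ha' : klDiv p ((1 / 2 : ℝ≥0∞) • (p + (1 / 2 : ℝ≥0∞) • (q + r))) = 0 := by
      simp only [mul_eq_zero, add_eq_zero] at ha
      rcases ha with ha | ⟨ha | ha, -⟩
      · norm_num at ha
      · norm_num at ha
      · exact ha
    rw [klDiv_zero_iff] at ha'
    have key : ∀ s, p.real s = q.real s ∧ q.real s = r.real s := by
      intro s
      have e1 := congrArg (fun μ : Measure X => μ.real s) ha'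
      have e2 := congrArg (fun μ : Measure X => μ.real s) hb
      simp only [real_add_fin, measureReal_ennreal_smul_apply,
        ENNReal.toReal_ofReal h0.le, ENNReal.toReal_ofReal (sub_pos.2 h1).le,
        ENNReal.toReal_div, ENNReal.toReal_one, ENNReal.toReal_ofNat] at e1 e2
      have e3 : p.real s = q.real s := by
        have : (2 - β) * (p.real s - q.real s) = 0 := by linarith
        rcases mul_eq_zero.1 this with h | h <;> linarith
      refine ⟨e3, ?_⟩
      rw [e3] at e2
      linarith
    constructor
    · ext s _
      exact (measureReal_eq_measureReal_iff).1 (key s).1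
    · ext s _
      exact (measureReal_eq_measureReal_iff).1 (key s).2
  · rintro ⟨rfl, rfl⟩
    have e : ENNReal.ofReal β • p + ENNReal.ofReal (1 - β) • p = p := by
      rw [← add_smul, ← ENNReal.ofReal_add h0.le (sub_pos.2 h1).le]
      simp
    have k : klDiv p p = 0 := (klDiv_zero_iff p p).2 rfl
    simp only [jsDiv, half_smul_add_self, e, k, mul_zero, add_zero]
end
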